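/- arXiv:1003.1293 — 2 statements merged into one kernel-verified Lean document; each statement's English description precedes it below -/
import Mathlib

section
/- Let m, n be positive integers with gcd(m, n) > 1, and let BS(m,n) = ⟨a, b ∣ b⁻¹aᵐb = aⁿ⟩ be the Baumslag–Solitar group, with generating set S = {a, b}. Then the conjugacy growth function of BS(m,n) with respect to S is exponential: there exists c > 1 such that g_c(n) ≥ c^n for all sufficiently large n. -/
/-- The ball of radius `n` in a group `G` with respect to a generating set `S`:
all products of at most `n` elements of `S ∪ S⁻¹`. -/
def wordBall {G : Type*} [Group G] (S : Set G) (n : ℕ) : Set G :=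
  {g | ∃ L : List G, L.length ≤ n ∧ (∀ x ∈ L, x ∈ S ∪ S⁻¹) ∧ L.prod = g}

/-- The conjugacy growth function: the number of conjugacy classes of `G`
intersecting the ball of radius `n`. -/
noncomputable def conjGrowth {G : Type*} [Group G] (S : Set G) (n : ℕ) : ℕ :=
  Nat.card {c : ConjClasses G // ∃ g ∈ wordBall S n, ConjClasses.mk g = c}

/-- The defining relation `b⁻¹ aᵐ b (aⁿ)⁻¹` of the Baumslag–Solitar group. -/
def bsRels (m n : ℕ) : Set (FreeGroup (Fin 2)) :=
  {(FreeGroup.of 1)⁻¹ * (FreeGroup.of 0) ^ m * FreeGroup.of 1 * ((FreeGroup.of 0) ^ n)⁻¹}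

/-- The Baumslag–Solitar group `BS(m,n) = ⟨a, b ∣ b⁻¹ aᵐ b = aⁿ⟩`. -/
abbrev BS (m n : ℕ) : Type := PresentedGroup (bsRels m n)

/-- The generator `a` of `BS(m,n)`. -/
def bsA (m n : ℕ) : BS m n := PresentedGroup.of 0

/-- The generator `b` of `BS(m,n)`. -/
def bsB (m n : ℕ) : BS m n := PresentedGroup.of 1

section WordBall

variable {G : Type*} [Group G] {S : Set G}

theorem one_mem_wordBall (n : ℕ) : (1 : G) ∈ wordBall S n :=
  ⟨[], by simp, by simp, rfl⟩

theorem wordBall_mono {i j : ℕ} (h : i ≤ j) : wordBall S i ⊆ wordBall S j := by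
  rintro g ⟨L, hL, hS, rfl⟩
  exact ⟨L, hL.trans h, hS, rfl⟩

theorem mul_mem_wordBall {i j : ℕ} {g h : G} (hg : g ∈ wordBall S i) (hh : h ∈ wordBall S j) :
    g * h ∈ wordBall S (i + j) := by
  obtain ⟨L, hL, hLS, rfl⟩ := hg
  obtain ⟨M, hM, hMS, rfl⟩ := hh
  refine ⟨L ++ M, by simp only [List.length_append]; omega, fun x hx ↦ ?_, List.prod_append⟩
  exact (List.mem_append.1 hx).elim (hLS x) (hMS x)

theorem mem_wordBall_one {g : G} (hg : g ∈ S ∪ S⁻¹) : g ∈ wordBall S 1 :=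
  ⟨[g], by simp, by simpa using hg, by simp⟩

theorem finite_wordBall (hS : S.Finite) (n : ℕ) : (wordBall S n).Finite := by
  have : Finite ↥(S ∪ S⁻¹) := (hS.union hS.inv).to_subtype
  refine ((List.finite_length_le ↥(S ∪ S⁻¹) n).image
    fun L ↦ (L.map Subtype.val).prod).subset ?_
  rintro g ⟨L, hL, hLS, rfl⟩
  lift L to List ↥(S ∪ S⁻¹) using hLS
  exact ⟨L, by simpa using hL, rfl⟩

/-- An injective family of conjugacy classes meeting the ball bounds `conjGrowth` from below. -/
theorem card_le_conjGrowth (hS : S.Finite) {n : ℕ} {ι : Type*} (w : ι → G)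
    (hw : ∀ i, w i ∈ wordBall S n) (hinj : ∀ i j, IsConj (w i) (w j) → i = j) :
    Nat.card ι ≤ conjGrowth S n := by
  have : Finite {c : ConjClasses G // ∃ g ∈ wordBall S n, ConjClasses.mk g = c} :=
    ((finite_wordBall hS n).image ConjClasses.mk).to_subtype
  refine Nat.card_le_card_of_injective (fun i ↦ ⟨ConjClasses.mk (w i), w i, hw i, rfl⟩) ?_
  intro i j hij
  exact hinj i j (ConjClasses.mk_eq_mk_iff_isConj.1 (congrArg Subtype.val hij))

end WordBall

section BitWord

variable {G H : Type*} [Group G] [Group H]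

/-- The word `a^{x₀} b a^{x₁} b ⋯ b⁻¹ b⁻¹` that encodes the bits `x₀, x₁, …` as lamps. -/
def bitWord (a b : G) : List Bool → G
  | [] => 1
  | x :: l => (if x then a else 1) * b * bitWord a b l * b⁻¹

theorem map_bitWord (φ : G →* H) (a b : G) (l : List Bool) :
    φ (bitWord a b l) = bitWord (φ a) (φ b) l := by
  induction l with
  | nil => simp [bitWord]
  | cons x l ih => cases x <;> simp [bitWord, ih]

theorem bitWord_mem_wordBall (a b : G) (l : List Bool) :
    bitWord a b l ∈ wordBall {a, b} (3 * l.length) := by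
  induction l with
  | nil => exact one_mem_wordBall _
  | cons x l ih =>
    have hx : (if x then a else 1) ∈ wordBall {a, b} 1 := by
      split_ifs
      · exact mem_wordBall_one (by simp)
      · exact one_mem_wordBall 1
    have hb : b ∈ wordBall {a, b} 1 := mem_wordBall_one (by simp)
    have hb' : b⁻¹ ∈ wordBall {a, b} 1 := mem_wordBall_one (by simp)
    refine wordBall_mono ?_ (mul_mem_wordBall (mul_mem_wordBall (mul_mem_wordBall hx hb) ih) hb')
    simp only [List.length_cons]
    omega

end BitWord

namespace Lamplighter

variable {D : Type*} [Group D]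

/-- The lamp at the origin, in state `t`. -/
def lamp (t : D) : D ≀ᵣ Multiplicative ℤ := ⟨Pi.mulSingle 1 t, 1⟩

/-- The unit step of the lamplighter. -/
def step : D ≀ᵣ Multiplicative ℤ := ⟨1, .ofAdd 1⟩

@[simp]
theorem lamp_right (t : D) : (lamp t).right = 1 := rfl

@[simp]
theorem step_right : (step : D ≀ᵣ Multiplicative ℤ).right = .ofAdd 1 := rfl

theorem lamp_pow (t : D) (k : ℕ) : lamp t ^ k = lamp (t ^ k) := by
  induction k with
  | zero => ext <;> simp [lamp]
  | succ k ih =>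
    rw [pow_succ, ih]
    ext i
    · by_cases hi : i = 1 <;> simp [lamp, hi, pow_succ]
    · simp [lamp]

theorem lamp_one : lamp (1 : D) = 1 := by
  ext <;> simp [lamp]

theorem bitWord_right (t : D) (l : List Bool) : (bitWord (lamp t) step l).right = 1 := by
  induction l with
  | nil => rfl
  | cons x l ih => cases x <;> simp [bitWord, ih]

theorem bitWord_cons_left (t : D) (x : Bool) (l : List Bool) (i : ℤ) :
    (bitWord (lamp t) step (x :: l)).left (.ofAdd i) =
      (if x = true ∧ i = 0 then t else 1) * (bitWord (lamp t) step l).left (.ofAdd (i - 1)) := by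
  have h : (Multiplicative.ofAdd (1 : ℤ))⁻¹ * .ofAdd i = .ofAdd (i - 1) := by
    rw [← ofAdd_neg, ← ofAdd_add]; congr 1; ring
  cases x
  · simp [bitWord, step, h]
  · by_cases hi : i = 0
    · subst hi
      simp [bitWord, step, lamp]
    · have : Multiplicative.ofAdd i ≠ 1 := by simpa using hi
      simp [bitWord, step, lamp, hi, this, h]

theorem bitWord_left_of_neg (t : D) (l : List Bool) {i : ℤ} (hi : i < 0) :
    (bitWord (lamp t) step l).left (.ofAdd i) = 1 := by
  induction l generalizing i with
  | nil => rfl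
  | cons x l ih =>
    rw [bitWord_cons_left, ih (show i - 1 < 0 by omega)]
    simp [hi.ne]

theorem bitWord_left_injective {t : D} (ht : t ≠ 1) {l l' : List Bool}
    (hlen : l.length = l'.length)
    (h : (bitWord (lamp t) step l).left = (bitWord (lamp t) step l').left) : l = l' := by
  induction l generalizing l' with
  | nil => exact (List.length_eq_zero_iff.1 hlen.symm).symm
  | cons x l ih =>
    obtain _ | ⟨y, l'⟩ := l'
    · simp at hlen
    have hval (i : ℤ) := congrFun h (.ofAdd i)
    simp only [bitWord_cons_left] at hval
    have hxy : x = y := by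
      have h0 := hval 0
      rw [bitWord_left_of_neg t l (by norm_num), bitWord_left_of_neg t l' (by norm_num)] at h0
      cases x <;> cases y <;> simp_all
    subst hxy
    rw [ih (by simpa using hlen)]
    funext i
    have hi := hval (i.toAdd + 1)
    rw [mul_left_cancel_iff, add_sub_cancel_right, ofAdd_toAdd] at hi
    exact hi

/-- Conjugate lamp configurations whose leftmost lit lamp is at the origin are equal. -/
theorem bitWord_eq_of_isConj {D : Type*} [CommGroup D] {t : D} (ht : t ≠ 1) {l l' : List Bool}
    (hlen : l.length = l'.length)
    (h : IsConj (bitWord (lamp t) step (true :: l)) (bitWord (lamp t) step (true :: l'))) :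
    l = l' := by
  have hzero (l : List Bool) : (bitWord (lamp t) step (true :: l)).left (.ofAdd 0) ≠ 1 := by
    rw [bitWord_cons_left, bitWord_left_of_neg t l (by norm_num)]
    simpa using ht
  obtain ⟨c, hc⟩ := isConj_iff.1 h
  have hc := eq_mul_inv_iff_mul_eq.1 hc.symm
  have hshift (i : ℤ) : (bitWord (lamp t) step (true :: l')).left (.ofAdd i) =
      (bitWord (lamp t) step (true :: l)).left (.ofAdd (i - c.right.toAdd)) := by
    have hi := congrFun (congrArg RegularWreathProduct.left hc) (.ofAdd i)
    simp only [RegularWreathProduct.mul_left, bitWord_right, Pi.mul_apply, inv_one, one_mul] at hi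
    rw [mul_comm, mul_left_cancel_iff] at hi
    rw [hi]
    congr 1
    rw [ofAdd_sub, div_eq_inv_mul, ofAdd_toAdd]
  have h1 : 0 ≤ c.right.toAdd := by
    by_contra! hneg
    have := hshift c.right.toAdd
    rw [bitWord_left_of_neg t _ hneg, sub_self] at this
    exact hzero l this.symm
  have h2 : c.right.toAdd ≤ 0 := by
    by_contra! hpos
    have := hshift 0
    rw [bitWord_left_of_neg t (true :: l) (by omega)] at this
    exact hzero l' this
  have h3 : c.right.toAdd = 0 := le_antisymm h2 h1
  have hleft : (bitWord (lamp t) step (true :: l)).left =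
      (bitWord (lamp t) step (true :: l')).left := by
    funext i
    simpa [h3] using (hshift i.toAdd).symm
  exact (List.cons.inj (bitWord_left_injective ht (by simpa using hlen) hleft)).2

/-- `BS(m,n)` maps onto the lamplighter group with lamp `t` whenever `tᵐ = tⁿ = 1`. -/
theorem exists_hom_of_BS {m n : ℕ} {t : D} (htm : t ^ m = 1) (htn : t ^ n = 1) :
    ∃ φ : BS m n →* D ≀ᵣ Multiplicative ℤ, φ (bsA m n) = lamp t ∧ φ (bsB m n) = step := by
  have hrel : ∀ r ∈ bsRels m n, FreeGroup.lift ![lamp t, step] r = 1 := by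
    rintro r rfl
    simp [lamp_pow, htm, htn, lamp_one]
  exact ⟨PresentedGroup.toGroup hrel, PresentedGroup.toGroup.of hrel,
    PresentedGroup.toGroup.of hrel⟩

end Lamplighter

theorem two_pow_le_conjGrowth_BS {m n : ℕ} (hgcd : 1 < Nat.gcd m n) (r : ℕ) :
    2 ^ r ≤ conjGrowth ({bsA m n, bsB m n} : Set (BS m n)) (3 * (r + 1)) := by
  have : Fact (1 < Nat.gcd m n) := ⟨hgcd⟩
  let t : Multiplicative (ZMod (Nat.gcd m n)) := .ofAdd 1
  have ht : t ≠ 1 := by simp [t]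
  have htpow {k : ℕ} (hk : Nat.gcd m n ∣ k) : t ^ k = 1 := by
    rw [← ofAdd_nsmul, nsmul_one, (ZMod.natCast_eq_zero_iff _ _).2 hk, ofAdd_zero]
  obtain ⟨φ, ha, hb⟩ := Lamplighter.exists_hom_of_BS (htpow (Nat.gcd_dvd_left m n))
    (htpow (Nat.gcd_dvd_right m n))
  have hcard : Nat.card (List.Vector Bool r) = 2 ^ r := by simp
  rw [← hcard]
  refine card_le_conjGrowth (Set.toFinite _)
    (fun l : List.Vector Bool r ↦ bitWord (bsA m n) (bsB m n) (true :: l.1)) (fun l ↦ ?_) ?_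
  · simpa [l.2] using bitWord_mem_wordBall (bsA m n) (bsB m n) (true :: l.1)
  · intro l l' h
    have h := φ.map_isConj h
    rw [map_bitWord, map_bitWord, ha, hb] at h
    exact Subtype.ext (Lamplighter.bitWord_eq_of_isConj ht (l.2.trans l'.2.symm) h)

theorem conjGrowth_mono {G : Type*} [Group G] {S : Set G} (hS : S.Finite) :
    Monotone (conjGrowth S) := by
  intro i j hij
  have : Finite {c : ConjClasses G // ∃ g ∈ wordBall S j, ConjClasses.mk g = c} :=
    ((finite_wordBall hS j).image ConjClasses.mk).to_subtype
  exact Nat.card_le_card_of_injective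
    (Subtype.map id fun _ ⟨g, hg, hc⟩ ↦ ⟨g, wordBall_mono hij hg, hc⟩)
    (Subtype.map_injective _ Function.injective_id)

/-- If `gcd(m,n) > 1`, the conjugacy growth function of `BS(m,n)` with respect to
`S = {a, b}` is exponential. -/
theorem bs_conj_growth_exponential (m n : ℕ) (hm : 0 < m) (hn : 0 < n)
    (hgcd : 1 < Nat.gcd m n) :
    ∃ c : ℝ, 1 < c ∧ ∃ N : ℕ, ∀ k ≥ N,
      c ^ k ≤ (conjGrowth ({bsA m n, bsB m n} : Set (BS m n)) k : ℝ) := by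
  obtain ⟨c, hc1, hc⟩ : ∃ c : ℝ, 1 < c ∧ c ^ 12 = 2 :=
    ⟨2 ^ (1 / 12 : ℝ), Real.one_lt_rpow (by norm_num) (by norm_num), by
      rw [← Real.rpow_natCast, ← Real.rpow_mul (by norm_num)]; norm_num⟩
  refine ⟨c, hc1, 7, fun k hk ↦ ?_⟩
  calc c ^ k ≤ c ^ (12 * (k / 3 - 1)) := pow_le_pow_right₀ hc1.le (by omega)
    _ = ((2 ^ (k / 3 - 1) : ℕ) : ℝ) := by rw [pow_mul, hc]; norm_cast
    _ ≤ _ := by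
      exact_mod_cast (two_pow_le_conjGrowth_BS hgcd _).trans
        (conjGrowth_mono (Set.toFinite _) (by omega))
end

section
/- Let n ≥ 2 and let BS(1,n) = ⟨a, b ∣ b⁻¹ab = aⁿ⟩. If k and l are distinct positive integers neither of which is divisible by n, then the elements a^k and a^l are not conjugate in BS(1,n). -/
/-- The permutations of `ℚ` that multiply all differences by a fixed integer power of `q`. -/
def powerAffineSubgroup (q : ℚ) (hq : q ≠ 0) : Subgroup (Equiv.Perm ℚ) where
  carrier := {f | ∃ j : ℤ, ∀ x y, f x - f y = q ^ j * (x - y)}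
  one_mem' := ⟨0, fun x y => by simp⟩
  mul_mem' := by
    rintro f g ⟨i, hf⟩ ⟨j, hg⟩
    refine ⟨i + j, fun x y => ?_⟩
    rw [Equiv.Perm.mul_apply, Equiv.Perm.mul_apply, hf, hg, zpow_add₀ hq, mul_assoc]
  inv_mem' := by
    rintro f ⟨j, hf⟩
    refine ⟨-j, fun x y => ?_⟩
    have h := hf (f⁻¹ x) (f⁻¹ y)
    rw [show f (f⁻¹ x) = x from f.apply_symm_apply x,
      show f (f⁻¹ y) = y from f.apply_symm_apply y] at h
    rw [h, ← mul_assoc, ← zpow_add₀ hq, neg_add_cancel, zpow_zero, one_mul]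

/-- The images of `a` and `b` in the action of `BS(1,n)` on `ℚ` by affine maps:
translation by `1` and division by `n`. -/
def bsAffineGen (n : ℕ) (hn : (n : ℚ) ≠ 0) : Fin 2 → Equiv.Perm ℚ :=
  ![Equiv.addRight 1, (Equiv.mulRight₀ (n : ℚ) hn)⁻¹]

theorem addRight_one_pow_apply (k : ℕ) (x : ℚ) :
    ((Equiv.addRight (1 : ℚ)) ^ k : Equiv.Perm ℚ) x = x + k := by
  simp

theorem lift_bsAffineGen_eq_one (n : ℕ) (hn : (n : ℚ) ≠ 0) :
    ∀ r ∈ bsRels 1 n, FreeGroup.lift (bsAffineGen n hn) r = 1 := by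
  rintro r rfl
  simp only [map_mul, map_inv, map_pow, FreeGroup.lift_apply_of, bsAffineGen,
    Matrix.cons_val_zero, Matrix.cons_val_one, inv_inv, pow_one]
  rw [mul_inv_eq_one]
  ext x
  rw [addRight_one_pow_apply, Equiv.Perm.mul_apply, Equiv.Perm.mul_apply]
  have h : ((Equiv.mulRight₀ (n : ℚ) hn)⁻¹ : Equiv.Perm ℚ) x * n = x :=
    (Equiv.mulRight₀ (n : ℚ) hn).apply_symm_apply x
  change ((Equiv.mulRight₀ (n : ℚ) hn)⁻¹ x + 1) * n = x + n
  rw [add_mul, h, one_mul]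

/-- The action of `BS(1,n)` on `ℚ` by affine maps. -/
def bsAffine (n : ℕ) (hn : (n : ℚ) ≠ 0) : BS 1 n →* Equiv.Perm ℚ :=
  PresentedGroup.toGroup (lift_bsAffineGen_eq_one n hn)

theorem bsAffine_bsA (n : ℕ) (hn : (n : ℚ) ≠ 0) :
    bsAffine n hn (bsA 1 n) = Equiv.addRight 1 :=
  PresentedGroup.toGroup.of _

theorem bsAffine_mem (n : ℕ) (hn : (n : ℚ) ≠ 0) (g : BS 1 n) :
    bsAffine n hn g ∈ powerAffineSubgroup n hn := by
  suffices h : (⊤ : Subgroup (BS 1 n)) ≤ (powerAffineSubgroup n hn).comap (bsAffine n hn) from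
    h (Subgroup.mem_top g)
  rw [← PresentedGroup.closure_range_of, Subgroup.closure_le]
  rintro _ ⟨i, rfl⟩
  change bsAffine n hn (PresentedGroup.of i) ∈ powerAffineSubgroup n hn
  rw [bsAffine, PresentedGroup.toGroup.of]
  fin_cases i
  · exact ⟨0, fun x y => by simp [bsAffineGen]⟩
  · exact (powerAffineSubgroup n hn).inv_mem (x := Equiv.mulRight₀ (n : ℚ) hn)
      ⟨1, fun x y => by simp; ring⟩

/-- Conjugate powers of `a` in `BS(1,n)` have exponents differing by a power of `n`. -/
theorem exists_zpow_mul_eq_of_isConj (n : ℕ) (hn : (n : ℚ) ≠ 0) (k l : ℕ)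
    (h : IsConj (bsA 1 n ^ k) (bsA 1 n ^ l)) : ∃ j : ℤ, (n : ℚ) ^ j * k = l := by
  obtain ⟨c, hc⟩ := isConj_iff.1 h
  obtain ⟨j, hj⟩ := bsAffine_mem n hn c
  have hφ := congrArg (bsAffine n hn) (mul_inv_eq_iff_eq_mul.1 hc)
  rw [map_mul, map_mul, map_pow, map_pow, bsAffine_bsA] at hφ
  have h0 := Equiv.congr_fun hφ 0
  rw [Equiv.Perm.mul_apply, Equiv.Perm.mul_apply, addRight_one_pow_apply,
    addRight_one_pow_apply, zero_add] at h0
  refine ⟨j, ?_⟩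
  have hk := hj k 0
  rw [h0, add_sub_cancel_left, sub_zero] at hk
  exact hk.symm

theorem dvd_of_pow_succ_mul_eq {n k l j : ℕ} (h : (n : ℚ) ^ (j + 1) * k = l) : n ∣ l := by
  have h' : n ^ (j + 1) * k = l := by exact_mod_cast h
  exact h' ▸ (dvd_pow_self n j.succ_ne_zero).mul_right k

/-- In `BS(1,n)` with `n ≥ 2`, if `k ≠ l` are distinct positive integers neither
of which is divisible by `n`, then `a^k` and `a^l` are not conjugate. -/
theorem bs_powers_not_conj (n : ℕ) (hn : 2 ≤ n) (k l : ℕ)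
    (hk : 0 < k) (hl : 0 < l) (hkl : k ≠ l) (hnk : ¬ n ∣ k) (hnl : ¬ n ∣ l) :
    ¬ IsConj (bsA 1 n ^ k) (bsA 1 n ^ l) := by
  intro h
  have hn0 : (n : ℚ) ≠ 0 := by positivity
  obtain ⟨j, hj⟩ := exists_zpow_mul_eq_of_isConj n hn0 k l h
  rcases j with (_ | j) | j
  · exact hkl (by simpa using hj)
  · exact hnl (dvd_of_pow_succ_mul_eq (by simpa only [Int.ofNat_eq_natCast, zpow_natCast] using hj))
  · rw [zpow_negSucc, inv_mul_eq_iff_eq_mul₀ (pow_ne_zero _ hn0)] at hj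
    exact hnk (dvd_of_pow_succ_mul_eq hj.symm)
end
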